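/- Let (g, Φ = (D, θ), ⟨·,·⟩) be an indecomposable extrinsic symmetric triple with n = dim g₋⁻ ≥ 1, let h be its mean curvature vector and A_h the associated shape operator on g₋⁻. Then either A_h is bijective, or A_h ∘ A_h = 0. -/

import Mathlib

/-- The span of all brackets `⁅u, v⁆` with `u ∈ U`, `v ∈ V`. -/
def bracketSpan {L : Type} [LieRing L] [LieAlgebra ℝ L]
    (U V : Submodule ℝ L) : Submodule ℝ L :=
  Submodule.span ℝ {z | ∃ u ∈ U, ∃ v ∈ V, z = ⁅u, v⁆}

/-- An extrinsic symmetric triple `(g, (D, θ), ⟨·,·⟩)`: a metric Lie algebra with an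
invariant nondegenerate symmetric bilinear form, an isometric involutive automorphism `θ`,
and an antisymmetric derivation `D` with `D³ = -D`, `Dθ = -θD` and `g₊⁺ = [g₊⁻, g₊⁻]`. -/
structure ExtSymTriple (L : Type) [LieRing L] [LieAlgebra ℝ L] [Module.Finite ℝ L] where
  B : LinearMap.BilinForm ℝ L
  Bsymm : ∀ x y, B x y = B y x
  Binv : ∀ x y z, B ⁅x, y⁆ z = B x ⁅y, z⁆
  Bnondeg : B.Nondegenerate
  theta : L →ₗ[ℝ] L
  thetaLie : ∀ x y, theta ⁅x, y⁆ = ⁅theta x, theta y⁆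
  thetaInvol : ∀ x, theta (theta x) = x
  thetaIso : ∀ x y, B (theta x) (theta y) = B x y
  D : L →ₗ[ℝ] L
  Dder : ∀ x y, D ⁅x, y⁆ = ⁅D x, y⁆ + ⁅x, D y⁆
  Danti : ∀ x y, B (D x) y = - B x (D y)
  D3 : ∀ x, D (D (D x)) = - D x
  Dtheta : ∀ x, D (theta x) = - theta (D x)
  cartan : (LinearMap.ker (theta - LinearMap.id) ⊓ LinearMap.ker D) =
    bracketSpan
      (LinearMap.ker (theta - LinearMap.id) ⊓ LinearMap.ker (D ∘ₗ D + LinearMap.id))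
      (LinearMap.ker (theta - LinearMap.id) ⊓ LinearMap.ker (D ∘ₗ D + LinearMap.id))

namespace ExtSymTriple

variable {L : Type} [LieRing L] [LieAlgebra ℝ L] [Module.Finite ℝ L] (T : ExtSymTriple L)

/-- `g₊⁺ = g₊ ∩ g⁺`. -/
def gPlusUp : Submodule ℝ L :=
  LinearMap.ker (T.theta - LinearMap.id) ⊓ LinearMap.ker T.D

/-- `g₊⁻ = g₊ ∩ g⁻`. -/
def gPlusDown : Submodule ℝ L :=
  LinearMap.ker (T.theta - LinearMap.id) ⊓ LinearMap.ker (T.D ∘ₗ T.D + LinearMap.id)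

/-- `g₋⁺ = g₋ ∩ g⁺`. -/
def gMinusUp : Submodule ℝ L :=
  LinearMap.ker (T.theta + LinearMap.id) ⊓ LinearMap.ker T.D

/-- `g₋⁻ = g₋ ∩ g⁻`. -/
def gMinusDown : Submodule ℝ L :=
  LinearMap.ker (T.theta + LinearMap.id) ⊓ LinearMap.ker (T.D ∘ₗ T.D + LinearMap.id)

/-- Indecomposability: `g` is not the direct sum of two nonzero ideals that are orthogonal
to each other and invariant under `θ` and `D`. -/
def Indecomposable : Prop :=
  ¬ ∃ I J : LieIdeal ℝ L, I ≠ ⊥ ∧ J ≠ ⊥ ∧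
    (I : Submodule ℝ L) ⊓ (J : Submodule ℝ L) = ⊥ ∧
    (I : Submodule ℝ L) ⊔ (J : Submodule ℝ L) = ⊤ ∧
    (∀ x ∈ I, ∀ y ∈ J, T.B x y = 0) ∧
    (∀ x ∈ I, T.theta x ∈ I) ∧ (∀ x ∈ I, T.D x ∈ I) ∧
    (∀ x ∈ J, T.theta x ∈ J) ∧ (∀ x ∈ J, T.D x ∈ J)

end ExtSymTriple

namespace ExtSymTriple

variable {L : Type} [LieRing L] [LieAlgebra ℝ L] [Module.Finite ℝ L] (T : ExtSymTriple L)

lemma eq_of_forall_B {x y : L} (hxy : ∀ z, T.B x z = T.B y z) : x = y :=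
  sub_eq_zero.mp <| T.Bnondeg.1 _ fun z => by simp [hxy z]

lemma ad_D (x : L) : LieAlgebra.ad ℝ L (T.D x) =
    (T.D * LieAlgebra.ad ℝ L x - LieAlgebra.ad ℝ L x * T.D : Module.End ℝ L) := by
  ext y
  simp [T.Dder]

lemma ad_theta (x : L) : LieAlgebra.ad ℝ L (T.theta x) =
    (T.theta * LieAlgebra.ad ℝ L x * T.theta : Module.End ℝ L) := by
  ext y
  simp [T.thetaLie, T.thetaInvol]

lemma killingForm_D_apply (x y : L) :
    killingForm ℝ L (T.D x) y = -killingForm ℝ L x (T.D y) := by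
  rw [killingForm_apply_apply, killingForm_apply_apply, T.ad_D, T.ad_D,
    ← Module.End.mul_eq_comp, ← Module.End.mul_eq_comp, eq_neg_iff_add_eq_zero, ← map_add]
  set X : Module.End ℝ L := LieAlgebra.ad ℝ L x
  set Y : Module.End ℝ L := LieAlgebra.ad ℝ L y
  have key : (T.D * X - X * T.D) * Y + X * (T.D * Y - Y * T.D) = T.D * (X * Y) - X * Y * T.D := by
    noncomm_ring
  rw [key, map_sub, LinearMap.trace_mul_comm ℝ T.D, sub_self]

lemma killingForm_theta (x y : L) :
    killingForm ℝ L (T.theta x) (T.theta y) = killingForm ℝ L x y := by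
  rw [killingForm_apply_apply, killingForm_apply_apply, T.ad_theta, T.ad_theta,
    ← Module.End.mul_eq_comp, ← Module.End.mul_eq_comp]
  set X : Module.End ℝ L := LieAlgebra.ad ℝ L x
  set Y : Module.End ℝ L := LieAlgebra.ad ℝ L y
  have hθ : (T.theta * T.theta : Module.End ℝ L) = 1 := by
    ext z
    simp [T.thetaInvol]
  have key : T.theta * X * T.theta * (T.theta * Y * T.theta) = T.theta * (X * Y * T.theta) := by
    calc _ = T.theta * X * (T.theta * T.theta) * Y * T.theta := by noncomm_ring
      _ = _ := by rw [hθ]; noncomm_ring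
  rw [key, LinearMap.trace_mul_comm, mul_assoc, hθ, mul_one]

/-- The endomorphism of `g` representing the Killing form with respect to `⟨·,·⟩`. -/
noncomputable def killingEnd : Module.End ℝ L :=
  (killingForm ℝ L).symmCompOfNondegenerate T.B T.Bnondeg

lemma B_killingEnd (x y : L) : T.B (T.killingEnd x) y = killingForm ℝ L x y :=
  LinearMap.BilinForm.symmCompOfNondegenerate_left_apply _ _ _ _

lemma B_killingEnd_comm (x y : L) : T.B (T.killingEnd x) y = T.B x (T.killingEnd y) := by
  rw [T.B_killingEnd, T.Bsymm x, T.B_killingEnd, LieModule.traceForm_comm]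

lemma killingEnd_lie (a x : L) : T.killingEnd ⁅a, x⁆ = ⁅a, T.killingEnd x⁆ :=
  T.eq_of_forall_B fun z => by
    rw [T.B_killingEnd, ← lie_skew, ← lie_skew a, map_neg, map_neg, LinearMap.neg_apply,
      LinearMap.neg_apply, T.Binv, T.B_killingEnd, LieModule.traceForm_apply_lie_apply]

lemma killingEnd_D (x : L) : T.killingEnd (T.D x) = T.D (T.killingEnd x) :=
  T.eq_of_forall_B fun z => by
    rw [T.B_killingEnd, T.Danti, T.B_killingEnd, T.killingForm_D_apply]

lemma killingEnd_theta (x : L) : T.killingEnd (T.theta x) = T.theta (T.killingEnd x) :=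
  T.eq_of_forall_B fun z => by
    rw [T.B_killingEnd, ← T.thetaInvol z, T.thetaIso, T.B_killingEnd, T.killingForm_theta]

lemma commute_killingEnd_ad (x : L) : Commute T.killingEnd (LieAlgebra.ad ℝ L x) :=
  LinearMap.ext (T.killingEnd_lie x)

lemma commute_killingEnd_D : Commute T.killingEnd T.D :=
  LinearMap.ext T.killingEnd_D

lemma commute_killingEnd_theta : Commute T.killingEnd T.theta :=
  LinearMap.ext T.killingEnd_theta

lemma killingEnd_pow_lie (m : ℕ) (a x : L) :
    (T.killingEnd ^ m) ⁅a, x⁆ = ⁅a, (T.killingEnd ^ m) x⁆ :=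
  LinearMap.congr_fun ((T.commute_killingEnd_ad a).pow_left m) x

lemma B_killingEnd_pow_comm (m : ℕ) (x y : L) :
    T.B ((T.killingEnd ^ m) x) y = T.B x ((T.killingEnd ^ m) y) := by
  induction m generalizing x y with
  | zero => rfl
  | succ m ih =>
    rw [pow_succ, Module.End.mul_apply, ih, T.B_killingEnd_comm, ← Module.End.mul_apply,
      (Commute.self_pow T.killingEnd m).eq]

lemma killingEnd_injective_or_isNilpotent (hT : T.Indecomposable) :
    Function.Injective T.killingEnd ∨ IsNilpotent T.killingEnd := by
  obtain ⟨m, hm, hm1⟩ := (T.killingEnd.eventually_isCompl_ker_pow_range_pow.and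
    (Filter.eventually_ge_atTop 1)).exists
  by_contra! hcon
  obtain ⟨hinj, hnil⟩ := hcon
  let I : LieIdeal ℝ L :=
    { LinearMap.ker (T.killingEnd ^ m) with
      lie_mem := by
        intro a x hx
        change (T.killingEnd ^ m) ⁅a, x⁆ = 0
        rw [T.killingEnd_pow_lie, LinearMap.mem_ker.mp hx, lie_zero] }
  let J : LieIdeal ℝ L :=
    { LinearMap.range (T.killingEnd ^ m) with
      lie_mem := by
        rintro a _ ⟨x, rfl⟩
        exact ⟨⁅a, x⁆, T.killingEnd_pow_lie m a x⟩ }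
  have hI : (I : Submodule ℝ L) = LinearMap.ker (T.killingEnd ^ m) := rfl
  have hJ : (J : Submodule ℝ L) = LinearMap.range (T.killingEnd ^ m) := rfl
  have hker : ∀ f : Module.End ℝ L, Commute T.killingEnd f → ∀ x ∈ I, f x ∈ I := by
    intro f hf x hx
    have := LinearMap.congr_fun (hf.pow_left m) x
    rw [Module.End.mul_apply, Module.End.mul_apply, LinearMap.mem_ker.mp hx, map_zero] at this
    exact this
  have hrange : ∀ f : Module.End ℝ L, Commute T.killingEnd f → ∀ x ∈ J, f x ∈ J := by
    rintro f hf _ ⟨x, rfl⟩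
    exact ⟨f x, LinearMap.congr_fun (hf.pow_left m) x⟩
  refine hT ⟨I, J, ?_, ?_, ?_, ?_, ?_, hker _ T.commute_killingEnd_theta,
    hker _ T.commute_killingEnd_D, hrange _ T.commute_killingEnd_theta,
    hrange _ T.commute_killingEnd_D⟩
  · intro h
    replace h := hI.symm.trans ((LieSubmodule.toSubmodule_eq_bot I).mpr h)
    rw [LinearMap.ker_eq_bot, Module.End.coe_pow] at h
    obtain ⟨k, rfl⟩ := Nat.exists_eq_add_of_le' hm1
    rw [Function.iterate_succ] at h
    exact hinj h.of_comp
  · intro h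
    replace h := hJ.symm.trans ((LieSubmodule.toSubmodule_eq_bot J).mpr h)
    exact hnil ⟨m, LinearMap.range_eq_bot.mp h⟩
  · rw [hI, hJ, hm.inf_eq_bot]
  · rw [hI, hJ, hm.sup_eq_top]
  · rintro x hx _ ⟨y, rfl⟩
    rw [← T.B_killingEnd_pow_comm, LinearMap.mem_ker.mp hx, map_zero, LinearMap.zero_apply]

lemma killingEnd_killingEnd_eq_zero (hnil : IsNilpotent T.killingEnd) (x : L) :
    T.killingEnd (T.killingEnd x) = 0 :=
  T.eq_of_forall_B fun y => by
    have had : LieAlgebra.ad ℝ L (T.killingEnd x) = T.killingEnd * LieAlgebra.ad ℝ L x := by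
      ext z
      simp only [LieAlgebra.ad_apply, Module.End.mul_apply]
      rw [← lie_skew, ← T.killingEnd_lie, ← map_neg, lie_skew]
    rw [T.B_killingEnd, killingForm_apply_apply, had, ← Module.End.mul_eq_comp, mul_assoc,
      map_zero, LinearMap.zero_apply]
    exact (LinearMap.isNilpotent_trace_of_isNilpotent (Commute.isNilpotent_mul_right
      ((T.commute_killingEnd_ad x).mul_right (T.commute_killingEnd_ad y)) hnil)).eq_zero

lemma D_lie_eq_zero {x y : L} (hx : T.D (T.D x) = -x) (hy : T.D (T.D y) = -y) :
    T.D ⁅x, y⁆ = 0 := by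
  have h3 := T.D3 ⁅x, y⁆
  simp only [T.Dder, map_add, hx, hy, neg_lie, lie_neg, map_neg] at h3 ⊢
  have : (3 : ℝ) • (⁅T.D x, y⁆ + ⁅x, T.D y⁆) = 0 := by
    linear_combination (norm := module) (-1 : ℝ) • h3
  exact (smul_eq_zero.mp this).resolve_left (by norm_num)

lemma mem_gMinusDown {x : L} :
    x ∈ T.gMinusDown ↔ T.theta x = -x ∧ T.D (T.D x) = -x := by
  simp [gMinusDown, eq_neg_iff_add_eq_zero]

/-- For `Dη = 0`, the operator `D ∘ ad η` has trace zero after composition with `θ`. -/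
lemma trace_D_ad_theta {η : L} (hη : T.D η = 0) :
    LinearMap.trace ℝ L (T.D * LieAlgebra.ad ℝ L η * T.theta) = 0 := by
  set E : Module.End ℝ L := LieAlgebra.ad ℝ L η
  have hE : T.D * E = E * T.D := by
    rw [← sub_eq_zero, ← T.ad_D, hη, map_zero]
  have hD : (T.D * (T.D * T.D) : Module.End ℝ L) = -T.D := LinearMap.ext T.D3
  have hθ : (T.D * T.theta : Module.End ℝ L) = -(T.theta * T.D) := LinearMap.ext T.Dtheta
  have h1 : T.D * E * T.theta = T.D * T.D * E * T.theta * T.D := by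
    calc T.D * E * T.theta = -(T.D * (T.D * T.D)) * E * T.theta := by rw [hD, neg_neg]
      _ = -(T.D * T.D * (T.D * E) * T.theta) := by noncomm_ring
      _ = -(T.D * T.D * E * (T.D * T.theta)) := by rw [hE]; noncomm_ring
      _ = _ := by rw [hθ]; noncomm_ring
  have h2 : T.D * (T.D * T.D * E * T.theta) = -(T.D * E * T.theta) := by
    calc _ = T.D * (T.D * T.D) * E * T.theta := by noncomm_ring
      _ = _ := by rw [hD]; noncomm_ring
  have h3 := congrArg (LinearMap.trace ℝ L) h1
  rw [LinearMap.trace_mul_comm ℝ _ T.D, h2, map_neg] at h3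
  linarith

/-- For `Dη = 0`, the trace of `D ∘ ad η` on `g` is twice its trace on `g₋⁻`. -/
lemma trace_D_ad {n : ℕ} {e : Fin n → L} (hmem : ∀ j, e j ∈ T.gMinusDown)
    (hspan : ∀ x ∈ T.gMinusDown, x ∈ Submodule.span ℝ (Set.range e))
    (horth : ∀ i j, i ≠ j → T.B (e i) (e j) = 0)
    {κ : Fin n → ℝ} (hκ : ∀ j, T.B (e j) (e j) = κ j) (hκ1 : ∀ j, κ j = 1 ∨ κ j = -1)
    {η : L} (hη : T.D η = 0) :
    LinearMap.trace ℝ L (T.D * LieAlgebra.ad ℝ L η) =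
      2 * ∑ j, κ j * T.B (e j) (T.D ⁅η, e j⁆) := by
  have hexp : ∀ x ∈ T.gMinusDown, ∑ j, κ j • T.B (e j) x • e j = x := by
    intro x hx
    replace hx := hspan x hx
    induction hx using Submodule.span_induction with
    | mem x hx' =>
      obtain ⟨i, rfl⟩ := hx'
      rw [Finset.sum_eq_single i]
      · rw [hκ, smul_smul]
        rcases hκ1 i with h | h <;> simp [h]
      · intro j _ hj
        simp [horth j i hj]
      · simp
    | zero => simp
    | add x y hx hy ihx ihy =>
      simp only [map_add, smul_add, add_smul, Finset.sum_add_distrib]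
      rw [ihx, ihy]
    | smul a x hx ihx =>
      conv_rhs => rw [← ihx, Finset.smul_sum]
      refine Finset.sum_congr rfl fun j _ => ?_
      rw [map_smul, smul_assoc, smul_comm]
  set E : Module.End ℝ L := LieAlgebra.ad ℝ L η with hEdef
  have hE : T.D * E = E * T.D := by
    rw [← sub_eq_zero, ← T.ad_D, hη, map_zero]
  have hD : (T.D * (T.D * T.D) : Module.End ℝ L) = -T.D := LinearMap.ext T.D3
  let p : Module.End ℝ L := (-(1 / 2) : ℝ) • (T.D * T.D * (1 - T.theta))
  have hp_apply : ∀ x, p x = (-(1 / 2) : ℝ) • (T.D (T.D x) - T.D (T.D (T.theta x))) := by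
    intro x
    simp [p]
  have hp_mem : ∀ x, p x ∈ T.gMinusDown := by
    intro x
    have hθD : ∀ y, T.theta (T.D y) = -T.D (T.theta y) := fun y => by rw [T.Dtheta, neg_neg]
    rw [T.mem_gMinusDown, hp_apply]
    constructor
    · simp only [map_smul, map_sub, hθD, T.thetaInvol, map_neg]
      module
    · simp only [map_smul, map_sub, T.D3, map_neg]
      module
  have hBp : ∀ j x, T.B (e j) (p x) = T.B (e j) x := by
    intro j x
    obtain ⟨h1, h2⟩ := T.mem_gMinusDown.mp (hmem j)
    have hDD : ∀ y, T.B (e j) (T.D (T.D y)) = -T.B (e j) y := fun y => by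
      rw [← neg_eq_iff_eq_neg, ← T.Danti, ← neg_eq_iff_eq_neg.mpr (T.Danti (T.D (e j)) y), h2]
      simp
    have hθ : T.B (e j) (T.theta x) = -T.B (e j) x := by
      rw [← T.thetaIso, T.thetaInvol, h1]
      simp
    rw [hp_apply, map_smul, map_sub, hDD, hDD, hθ, smul_eq_mul]
    ring
  have hp : p = ∑ j, κ j • (T.B (e j)).smulRight (e j) := by
    ext x
    rw [← hexp _ (hp_mem x)]
    simp [hBp]
  have htr : LinearMap.trace ℝ L (T.D * E * p) = ∑ j, κ j * T.B (e j) (T.D ⁅η, e j⁆) := by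
    rw [hp, Finset.mul_sum, map_sum]
    refine Finset.sum_congr rfl fun j _ => ?_
    have : T.D * E * (κ j • (T.B (e j)).smulRight (e j)) =
        κ j • (T.B (e j)).smulRight (T.D ⁅η, e j⁆) := by
      ext x
      simp [hEdef]
    rw [this, map_smul, LinearMap.trace_smulRight, smul_eq_mul]
  have hsplit : T.D * E * p =
      (1 / 2 : ℝ) • (T.D * E) - (1 / 2 : ℝ) • (T.D * E * T.theta) := by
    have h1 : T.D * E * (T.D * T.D) = -(T.D * E) := by
      calc _ = T.D * (E * T.D) * T.D := by noncomm_ring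
        _ = T.D * T.D * E * T.D := by rw [← hE, ← mul_assoc]
        _ = T.D * T.D * (E * T.D) := by rw [mul_assoc]
        _ = T.D * (T.D * T.D) * E := by rw [← hE]; noncomm_ring
        _ = _ := by rw [hD, neg_mul]
    have h2 : T.D * E * p = (-(1 / 2) : ℝ) • (T.D * E * (T.D * T.D) * (1 - T.theta)) := by
      simp only [p, mul_smul_comm, mul_assoc]
    rw [h2, h1, mul_sub, mul_one, neg_mul]
    module
  rw [hsplit, map_sub, map_smul, map_smul, T.trace_D_ad_theta hη, smul_eq_mul] at htr
  rw [← htr]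
  simp

/-- The Killing form is a trace form for the second fundamental form `(x, y) ↦ ⁅Dx, y⁆`. -/
lemma trace_D_ad_lie {x : L} (y : L) (hx : T.D (T.D x) = -x) :
    LinearMap.trace ℝ L (T.D * LieAlgebra.ad ℝ L ⁅T.D x, y⁆) = -killingForm ℝ L x y := by
  have had : LieAlgebra.ad ℝ L x =
      (LieAlgebra.ad ℝ L (T.D x) * T.D - T.D * LieAlgebra.ad ℝ L (T.D x) : Module.End ℝ L) := by
    rw [← neg_sub, ← T.ad_D, hx, map_neg, neg_neg]
  have hlie : LieAlgebra.ad ℝ L ⁅T.D x, y⁆ =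
      (LieAlgebra.ad ℝ L (T.D x) * LieAlgebra.ad ℝ L y -
        LieAlgebra.ad ℝ L y * LieAlgebra.ad ℝ L (T.D x) : Module.End ℝ L) := by
    ext z
    simp
  rw [killingForm_apply_apply, ← Module.End.mul_eq_comp, had, hlie]
  set X : Module.End ℝ L := LieAlgebra.ad ℝ L (T.D x)
  set Y : Module.End ℝ L := LieAlgebra.ad ℝ L y
  have h := LinearMap.trace_mul_comm ℝ (T.D * Y) X
  rw [sub_mul, mul_sub, map_sub, map_sub, ← mul_assoc, ← mul_assoc, h, mul_assoc X T.D Y]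
  ring

end ExtSymTriple

/-- **Lemma 2.** For an indecomposable extrinsic symmetric triple, the shape operator
`A_h : g₋⁻ → g₋⁻`, `A_h u = -⁅Du, h⁆`, is either bijective or satisfies `A_h ∘ A_h = 0`
(note `A_h (A_h u) = ⁅D ⁅Du, h⁆, h⁆`). -/
theorem shape_bijective_or_sq_zero
    {L : Type} [LieRing L] [LieAlgebra ℝ L] [Module.Finite ℝ L]
    (T : ExtSymTriple L) (hindec : T.Indecomposable)
    (n : ℕ) (hn : 1 ≤ n) (hdim : n = Module.finrank ℝ T.gMinusDown)
    (e : Fin n → L) (hmem : ∀ j, e j ∈ T.gMinusDown)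
    (hspan : ∀ x ∈ T.gMinusDown, x ∈ Submodule.span ℝ (Set.range e))
    (horth : ∀ i j, i ≠ j → T.B (e i) (e j) = 0)
    (κ : Fin n → ℝ) (hκ : ∀ j, T.B (e j) (e j) = κ j) (hκ1 : ∀ j, κ j = 1 ∨ κ j = -1)
    (h : L) (hh : h = (n : ℝ)⁻¹ • ∑ j, κ j • ⁅T.D (e j), e j⁆) :
    ((∀ u ∈ T.gMinusDown, -⁅T.D u, h⁆ = 0 → u = 0) ∧
      (∀ v ∈ T.gMinusDown, ∃ u ∈ T.gMinusDown, -⁅T.D u, h⁆ = v)) ∨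
    (∀ u ∈ T.gMinusDown, ⁅T.D ⁅T.D u, h⁆, h⁆ = 0) := by
  have hn0 : (n : ℝ) ≠ 0 := Nat.cast_ne_zero.mpr (by omega)
  have hDh : T.D h = 0 := by
    rw [hh, map_smul, map_sum, Finset.sum_eq_zero, smul_zero]
    intro j _
    have hj := (T.mem_gMinusDown.mp (hmem j)).2
    rw [map_smul, T.D_lie_eq_zero (by rw [hj, map_neg]) hj, smul_zero]
  have htrace : ∀ η, T.D η = 0 →
      LinearMap.trace ℝ L (T.D * LieAlgebra.ad ℝ L η) = 2 * n * T.B h η := by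
    intro η hη
    have hB : T.B h η = (n : ℝ)⁻¹ * ∑ j, κ j * T.B (e j) (T.D ⁅η, e j⁆) := by
      rw [hh]
      simp only [map_smul, map_sum, LinearMap.smul_apply, LinearMap.sum_apply, smul_eq_mul]
      congr 1
      refine Finset.sum_congr rfl fun j _ => ?_
      rw [T.Binv, T.Danti, ← map_neg, ← map_neg, lie_skew]
    rw [T.trace_D_ad hmem hspan horth hκ hκ1 hη, hB]
    field_simp
  have hK : ∀ x, T.D (T.D x) = -x → T.killingEnd x = (2 * n : ℝ) • ⁅T.D x, h⁆ := by
    intro x hx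
    refine T.eq_of_forall_B fun y => ?_
    have hy : y = (y + T.D (T.D y)) - T.D (T.D y) := by abel
    have hlie : T.D ⁅x, h⁆ = ⁅T.D x, h⁆ := by rw [T.Dder, hDh, lie_zero, add_zero]
    have hup : ∀ z, T.D z = 0 →
        T.B (T.killingEnd x) z = T.B ((2 * n : ℝ) • ⁅T.D x, h⁆) z := by
      intro z hz
      rw [← hlie, map_smul, LinearMap.smul_apply, T.Danti, hz, T.B_killingEnd,
        ← neg_eq_iff_eq_neg.mpr hx, map_neg, LinearMap.neg_apply, T.killingForm_D_apply, hz]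
      simp
    have hdown : ∀ z, T.D (T.D z) = -z →
        T.B (T.killingEnd x) z = T.B ((2 * n : ℝ) • ⁅T.D x, h⁆) z := by
      intro z hz
      have h1 := htrace ⁅T.D x, z⁆ (T.D_lie_eq_zero (by rw [hx, map_neg]) hz)
      rw [T.trace_D_ad_lie z hx, ← T.Binv, ← lie_skew, map_neg, LinearMap.neg_apply] at h1
      rw [T.B_killingEnd, map_smul, LinearMap.smul_apply, smul_eq_mul]
      linarith
    rw [hy, map_sub, map_sub, hup _ (by rw [map_add, T.D3, add_neg_cancel]),
      hdown _ (by rw [T.D3])]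
  have h2n : (2 * n : ℝ) ≠ 0 := mul_ne_zero two_ne_zero hn0
  rcases T.killingEnd_injective_or_isNilpotent hindec with hinj | hnil
  · refine Or.inl ⟨fun u hu hu0 => ?_, fun v hv => ?_⟩
    · apply hinj
      rw [hK u (T.mem_gMinusDown.mp hu).2, neg_eq_zero.mp hu0, smul_zero, map_zero]
    · obtain ⟨w, rfl⟩ := LinearMap.injective_iff_surjective.mp hinj v
      obtain ⟨hv1, hv2⟩ := T.mem_gMinusDown.mp hv
      rw [← T.killingEnd_theta, ← map_neg] at hv1
      rw [← T.killingEnd_D, ← T.killingEnd_D, ← map_neg] at hv2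
      have hw : w ∈ T.gMinusDown := T.mem_gMinusDown.mpr ⟨hinj hv1, hinj hv2⟩
      refine ⟨(-(2 * n) : ℝ) • w, Submodule.smul_mem _ _ hw, ?_⟩
      rw [hK w (hinj hv2), map_smul, smul_lie]
      module
  · refine Or.inr fun u hu => ?_
    have hu2 := (T.mem_gMinusDown.mp hu).2
    have h0 := T.killingEnd_killingEnd_eq_zero hnil u
    have hA : T.D (T.D ⁅T.D u, h⁆) = -⁅T.D u, h⁆ := by
      simp only [T.Dder, hDh, lie_zero, add_zero, T.D3, neg_lie]
    rw [hK u hu2, map_smul, hK _ hA, smul_smul] at h0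
    exact (smul_eq_zero.mp h0).resolve_left (mul_ne_zero h2n h2n)
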